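/- arXiv:2405.20023 — 3 statements merged into one kernel-verified Lean document; each statement's English description precedes it below -/
import Mathlib

section
/- Suppose Ω = XΓXᵀ + XΞZᵀ + ZΞᵀXᵀ + ZΔZᵀ, where Γ is a real k×k symmetric positive definite matrix, Ξ is a real k×(n−k) matrix, and Δ is a real (n−k)×(n−k) symmetric positive definite matrix. Then Γ − ΞΔ⁻¹Ξᵀ is positive definite, and setting A = (Γ − ΞΔ⁻¹Ξᵀ)⁻¹, B = −AΞΔ⁻¹, C = Bᵀ and D = Δ⁻¹ + BᵀA⁻¹B, one has Ω⁻¹ = X(XᵀX)⁻¹A(XᵀX)⁻¹Xᵀ + X(XᵀX)⁻¹B(ZᵀZ)⁻¹Zᵀ + Z(ZᵀZ)⁻¹C(XᵀX)⁻¹Xᵀ + Z(ZᵀZ)⁻¹D(ZᵀZ)⁻¹Zᵀ. -/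
open Matrix

lemma aux_unit (n m : ℕ) (X : Matrix (Fin n) (Fin m) ℝ) (hX : X.rank = m) :
    IsUnit (Xᵀ * X).det := by
  have h : (Xᵀ * X).rank = m := by rw [rank_transpose_mul_self, hX]
  rw [← Matrix.isUnit_iff_isUnit_det, ← Matrix.mulVec_surjective_iff_isUnit]
  have h2 : LinearMap.range (Xᵀ * X).mulVecLin = ⊤ := by
    apply Submodule.eq_top_of_finrank_eq
    simpa [Matrix.rank] using h
  exact LinearMap.range_eq_top.mp h2

theorem stmt_1 (n k : ℕ) (hk : 0 < k) (hn : k < n)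
    (X : Matrix (Fin n) (Fin k) ℝ) (hX : X.rank = k)
    (Z : Matrix (Fin n) (Fin (n - k)) ℝ) (hXZ : Xᵀ * Z = 0) (hZ : Z.rank = n - k)
    (Ω : Matrix (Fin n) (Fin n) ℝ) (hΩ : Ω.PosDef)
    (Γ : Matrix (Fin k) (Fin k) ℝ) (hΓ : Γ.PosDef)
    (Ξ : Matrix (Fin k) (Fin (n - k)) ℝ)
    (Δ : Matrix (Fin (n - k)) (Fin (n - k)) ℝ) (hΔ : Δ.PosDef)
    (hrep : Ω = X * Γ * Xᵀ + X * Ξ * Zᵀ + Z * Ξᵀ * Xᵀ + Z * Δ * Zᵀ)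
    (A : Matrix (Fin k) (Fin k) ℝ) (hA : A = (Γ - Ξ * Δ⁻¹ * Ξᵀ)⁻¹)
    (B : Matrix (Fin k) (Fin (n - k)) ℝ) (hB : B = -(A * Ξ * Δ⁻¹))
    (C : Matrix (Fin (n - k)) (Fin k) ℝ) (hC : C = Bᵀ)
    (D : Matrix (Fin (n - k)) (Fin (n - k)) ℝ) (hD : D = Δ⁻¹ + Bᵀ * A⁻¹ * B) :
    (Γ - Ξ * Δ⁻¹ * Ξᵀ).PosDef ∧
      Ω⁻¹ = X * (Xᵀ * X)⁻¹ * A * (Xᵀ * X)⁻¹ * Xᵀ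
          + X * (Xᵀ * X)⁻¹ * B * (Zᵀ * Z)⁻¹ * Zᵀ
          + Z * (Zᵀ * Z)⁻¹ * C * (Xᵀ * X)⁻¹ * Xᵀ
          + Z * (Zᵀ * Z)⁻¹ * D * (Zᵀ * Z)⁻¹ * Zᵀ := by
  have uX := aux_unit n k X hX
  have uZ := aux_unit n (n - k) Z hZ
  have hZX : Zᵀ * X = 0 := by
    have := congrArg Matrix.transpose hXZ
    simpa using this
  have hΔs : Δᵀ = Δ := by simpa using hΔ.isHermitian.eq
  have hΓs : Γᵀ = Γ := by simpa using hΓ.isHermitian.eq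
  have hΔis : Δ⁻¹ᵀ = Δ⁻¹ := by rw [transpose_nonsing_inv, hΔs]
  have uΔ : IsUnit Δ.det := (Matrix.isUnit_iff_isUnit_det _).mp hΔ.isUnit
  have hGs : (Xᵀ * X)⁻¹ᵀ = (Xᵀ * X)⁻¹ := by rw [transpose_nonsing_inv]; simp
  have hHs : (Zᵀ * Z)⁻¹ᵀ = (Zᵀ * Z)⁻¹ := by rw [transpose_nonsing_inv]; simp
  obtain ⟨P, hP⟩ : ∃ P, P = X * (Xᵀ * X)⁻¹ := ⟨_, rfl⟩
  obtain ⟨Q, hQ⟩ : ∃ Q, Q = Z * (Zᵀ * Z)⁻¹ := ⟨_, rfl⟩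
  have hPt : Pᵀ = (Xᵀ * X)⁻¹ * Xᵀ := by rw [hP, transpose_mul, hGs]
  have hQt : Qᵀ = (Zᵀ * Z)⁻¹ * Zᵀ := by rw [hQ, transpose_mul, hHs]
  have e1 : Xᵀ * P = 1 := by rw [hP, ← Matrix.mul_assoc, mul_nonsing_inv _ uX]
  have e2 : Zᵀ * P = 0 := by rw [hP, ← Matrix.mul_assoc, hZX, Matrix.zero_mul]
  have e3 : Zᵀ * Q = 1 := by rw [hQ, ← Matrix.mul_assoc, mul_nonsing_inv _ uZ]
  have e4 : Xᵀ * Q = 0 := by rw [hQ, ← Matrix.mul_assoc, hXZ, Matrix.zero_mul]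
  have f1 : Pᵀ * X = 1 := by simpa using congrArg Matrix.transpose e1
  have f2 : Pᵀ * Z = 0 := by simpa using congrArg Matrix.transpose e2
  have f3 : Qᵀ * Z = 1 := by simpa using congrArg Matrix.transpose e3
  have f4 : Qᵀ * X = 0 := by simpa using congrArg Matrix.transpose e4
  have hone : X * Pᵀ + Z * Qᵀ = 1 := by
    rw [← fromCols_mul_fromRows]
    have e : Fin n ≃ Fin k ⊕ Fin (n - k) := Fintype.equivOfCardEq (by simp; omega)
    rw [mul_eq_one_comm_of_equiv e, fromRows_mul_fromCols, f1, f2, f3, f4, fromBlocks_one]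
  have hΩP : Ω * P = X * Γ + Z * Ξᵀ := by
    rw [hrep]; simp only [Matrix.add_mul, Matrix.mul_assoc, e1, e2]; simp
  have hΩQ : Ω * Q = X * Ξ + Z * Δ := by
    rw [hrep]; simp only [Matrix.add_mul, Matrix.mul_assoc, e3, e4]; simp
  obtain ⟨S, hS⟩ : ∃ S, S = Γ - Ξ * Δ⁻¹ * Ξᵀ := ⟨_, rfl⟩
  have hΩW : Ω * (P - Q * (Δ⁻¹ * Ξᵀ)) = X * S := by
    rw [Matrix.mul_sub, ← Matrix.mul_assoc Ω Q, hΩP, hΩQ, hS, Matrix.add_mul, Matrix.mul_sub,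
      Matrix.mul_assoc Z Δ, mul_nonsing_inv_cancel_left _ _ uΔ]
    simp only [Matrix.mul_assoc]
    abel
  have hXW : Xᵀ * (P - Q * (Δ⁻¹ * Ξᵀ)) = 1 := by
    rw [Matrix.mul_sub, ← Matrix.mul_assoc, e1, e4]; simp
  have hWX : (P - Q * (Δ⁻¹ * Ξᵀ))ᵀ * X = 1 := by
    simpa using congrArg Matrix.transpose hXW
  have hSpd : S.PosDef := by
    have h := hΩ.conjTranspose_mul_mul_same (B := P - Q * (Δ⁻¹ * Ξᵀ)) (by
      intro u v huv
      have := congrArg (fun w => Xᵀ *ᵥ w) huv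
      simpa only [mulVec_mulVec, hXW, one_mulVec] using this)
    rwa [conjTranspose_eq_transpose_of_trivial, Matrix.mul_assoc, hΩW, ← Matrix.mul_assoc, hWX,
      Matrix.one_mul] at h
  rw [← hS] at hA ⊢
  refine ⟨hSpd, ?_⟩
  have uS : IsUnit S.det := (Matrix.isUnit_iff_isUnit_det _).mp hSpd.isUnit
  have hSs : Sᵀ = S := by simpa using hSpd.isHermitian.eq
  have hAs : Aᵀ = A := by rw [hA, transpose_nonsing_inv, hSs]
  have hSA : S * A = 1 := by rw [hA, mul_nonsing_inv _ uS]
  have hAi : A⁻¹ = S := by rw [hA, nonsing_inv_nonsing_inv _ uS]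
  have hC' : C = -(Δ⁻¹ * Ξᵀ * A) := by
    rw [hC, hB]; simp [hAs, hΔis, Matrix.mul_assoc]
  have hD' : D = Δ⁻¹ - C * Ξ * Δ⁻¹ := by
    rw [hD, hAi, ← hC, Matrix.mul_assoc, hB, Matrix.mul_neg, ← Matrix.mul_assoc, ← Matrix.mul_assoc,
      hSA, Matrix.one_mul, Matrix.mul_neg, ← Matrix.mul_assoc, sub_eq_add_neg]
  have g1 : Γ * A + Ξ * C = 1 := by
    rw [← hSA, hS, hC', Matrix.sub_mul]
    simp only [Matrix.mul_neg, Matrix.mul_assoc]; abel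
  have g2 : Ξᵀ * A + Δ * C = 0 := by
    rw [hC', Matrix.mul_neg, Matrix.mul_assoc, mul_nonsing_inv_cancel_left _ _ uΔ]; abel
  have g3 : Γ * B + Ξ * D = 0 := by
    have : Γ * B + Ξ * D = Ξ * Δ⁻¹ - (Γ * A + Ξ * C) * (Ξ * Δ⁻¹) := by
      rw [hD', hB]
      simp only [Matrix.mul_neg, Matrix.mul_assoc, Matrix.mul_sub, Matrix.add_mul]; abel
    rw [this, g1, Matrix.one_mul, sub_self]
  have g4 : Ξᵀ * B + Δ * D = 1 := by
    have : Ξᵀ * B + Δ * D = Δ * Δ⁻¹ - (Ξᵀ * A + Δ * C) * (Ξ * Δ⁻¹) := by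
      rw [hD', hB]
      simp only [Matrix.mul_neg, Matrix.mul_assoc, Matrix.mul_sub, Matrix.add_mul]; abel
    rw [this, g2, Matrix.zero_mul, sub_zero, mul_nonsing_inv _ uΔ]
  apply inv_eq_right_inv
  have hR : X * (Xᵀ * X)⁻¹ * A * (Xᵀ * X)⁻¹ * Xᵀ
          + X * (Xᵀ * X)⁻¹ * B * (Zᵀ * Z)⁻¹ * Zᵀ
          + Z * (Zᵀ * Z)⁻¹ * C * (Xᵀ * X)⁻¹ * Xᵀ
          + Z * (Zᵀ * Z)⁻¹ * D * (Zᵀ * Z)⁻¹ * Zᵀ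
        = P * (A * Pᵀ) + P * (B * Qᵀ) + Q * (C * Pᵀ) + Q * (D * Qᵀ) := by
    rw [hPt, hQt, hP, hQ]; simp only [Matrix.mul_assoc]
  rw [hR]
  calc Ω * (P * (A * Pᵀ) + P * (B * Qᵀ) + Q * (C * Pᵀ) + Q * (D * Qᵀ))
      = (Ω * P) * (A * Pᵀ) + (Ω * P) * (B * Qᵀ) + (Ω * Q) * (C * Pᵀ) + (Ω * Q) * (D * Qᵀ) := by
        simp only [Matrix.mul_add, Matrix.mul_assoc]
    _ = X * ((Γ * A + Ξ * C) * Pᵀ) + X * ((Γ * B + Ξ * D) * Qᵀ)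
        + Z * ((Ξᵀ * A + Δ * C) * Pᵀ) + Z * ((Ξᵀ * B + Δ * D) * Qᵀ) := by
        rw [hΩP, hΩQ]
        simp only [Matrix.mul_add, Matrix.add_mul, Matrix.mul_assoc]; abel
    _ = 1 := by
        rw [g1, g2, g3, g4, ← hone]; simp
end

section
/- Let K₁ and K₂ be real k×k symmetric positive semidefinite matrices. Then β̂(Ω,K₁)y = β̂(I_n,K₂)y for every y ∈ ℝⁿ if and only if both of the following hold: (a) Ω = XΓXᵀ + ZΔZᵀ for some real k×k symmetric positive definite matrix Γ and some real (n−k)×(n−k) symmetric positive definite matrix Δ; and (b) (XᵀΩ⁻¹X + K₁)⁻¹XᵀΩ⁻¹Xβ = (XᵀX + K₂)⁻¹XᵀXβ for every β ∈ ℝᵏ (equality of the expectations of the two estimators under the model E[y] = Xβ). -/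
open Matrix

/-- The general ridge estimator `β̂(Φ,K) y = (XᵀΦ⁻¹X + K)⁻¹ XᵀΦ⁻¹ y`. -/
noncomputable def ridge {n k : ℕ} (X : Matrix (Fin n) (Fin k) ℝ)
    (Φ : Matrix (Fin n) (Fin n) ℝ) (K : Matrix (Fin k) (Fin k) ℝ)
    (y : Fin n → ℝ) : Fin k → ℝ :=
  ((Xᵀ * Φ⁻¹ * X + K)⁻¹ * Xᵀ * Φ⁻¹).mulVec y

theorem inj_of_rank {n k : ℕ} (X : Matrix (Fin n) (Fin k) ℝ) (hX : X.rank = k) :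
    Function.Injective X.mulVec := by
  rw [Matrix.mulVec_injective_iff, linearIndependent_iff_card_eq_finrank_span]
  rw [Matrix.rank_eq_finrank_span_cols] at hX
  simp [Set.finrank, hX]

theorem gram_unit {n k : ℕ} (X : Matrix (Fin n) (Fin k) ℝ) (hX : X.rank = k) :
    IsUnit (Xᵀ * X).det := by
  have h := Matrix.PosDef.conjTranspose_mul_self X (inj_of_rank X hX)
  rw [conjTranspose_eq_transpose_of_trivial] at h
  exact (Matrix.isUnit_iff_isUnit_det _).1 h.isUnit

theorem key_one {n k : ℕ} (hn : k < n)
    (X : Matrix (Fin n) (Fin k) ℝ) (hX : X.rank = k)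
    (Z : Matrix (Fin n) (Fin (n - k)) ℝ) (hXZ : Xᵀ * Z = 0) (hZ : Z.rank = n - k) :
    X * (Xᵀ * X)⁻¹ * Xᵀ + Z * (Zᵀ * Z)⁻¹ * Zᵀ = 1 := by
  have hZX : Zᵀ * X = 0 := by
    have := congrArg Matrix.transpose hXZ
    simpa using this
  have e : Fin k ⊕ Fin (n - k) ≃ Fin n := Fintype.equivOfCardEq (by simp; omega)
  have h : Matrix.fromRows ((Xᵀ * X)⁻¹ * Xᵀ) ((Zᵀ * Z)⁻¹ * Zᵀ) * Matrix.fromCols X Z = 1 := by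
    rw [Matrix.fromRows_mul_fromCols, Matrix.mul_assoc, Matrix.mul_assoc, Matrix.mul_assoc,
      Matrix.mul_assoc, hXZ, hZX, Matrix.nonsing_inv_mul _ (gram_unit X hX),
      Matrix.nonsing_inv_mul _ (gram_unit Z hZ)]
    simp
  rw [Matrix.mul_eq_one_comm_of_equiv e, Matrix.fromCols_mul_fromRows] at h
  simpa only [Matrix.mul_assoc] using h

theorem transp_inv {n k : ℕ} (X : Matrix (Fin n) (Fin k) ℝ) :
    ((Xᵀ * X)⁻¹)ᵀ = (Xᵀ * X)⁻¹ := by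
  rw [Matrix.transpose_nonsing_inv]; simp

theorem pd_comp {n k : ℕ} (X : Matrix (Fin n) (Fin k) ℝ) (hX : X.rank = k)
    (Ω : Matrix (Fin n) (Fin n) ℝ) (hΩ : Ω.PosDef) :
    ((Xᵀ * X)⁻¹ * Xᵀ * Ω * X * (Xᵀ * X)⁻¹).PosDef := by
  have hi : Function.Injective (X * (Xᵀ * X)⁻¹).mulVec := by
    have h1 : Xᵀ * (X * (Xᵀ * X)⁻¹) = 1 := by
      rw [← Matrix.mul_assoc, Matrix.mul_nonsing_inv _ (gram_unit X hX)]
    intro a b hab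
    have := congrArg (Xᵀ.mulVec) hab
    simpa only [Matrix.mulVec_mulVec, h1, Matrix.one_mulVec] using this
  have h := hΩ.conjTranspose_mul_mul_same hi
  rw [conjTranspose_eq_transpose_of_trivial, Matrix.transpose_mul, transp_inv] at h
  simpa only [Matrix.mul_assoc] using h

theorem ridge_unit {n k : ℕ} (X : Matrix (Fin n) (Fin k) ℝ) (hX : X.rank = k)
    (Ω : Matrix (Fin n) (Fin n) ℝ) (hΩ : Ω.PosDef) (K : Matrix (Fin k) (Fin k) ℝ)
    (hK : K.PosSemidef) : IsUnit (Xᵀ * Ω⁻¹ * X + K).det := by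
  have h := hΩ.inv.conjTranspose_mul_mul_same (inj_of_rank X hX)
  rw [conjTranspose_eq_transpose_of_trivial] at h
  exact (Matrix.isUnit_iff_isUnit_det _).1 (h.add_posSemidef hK).isUnit

theorem stmt_10 (n k : ℕ) (hk : 0 < k) (hn : k < n)
    (X : Matrix (Fin n) (Fin k) ℝ) (hX : X.rank = k)
    (Z : Matrix (Fin n) (Fin (n - k)) ℝ) (hXZ : Xᵀ * Z = 0) (hZ : Z.rank = n - k)
    (Ω : Matrix (Fin n) (Fin n) ℝ) (hΩ : Ω.PosDef)
    (K₁ K₂ : Matrix (Fin k) (Fin k) ℝ) (hK₁ : K₁.PosSemidef) (hK₂ : K₂.PosSemidef) :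
    (∀ y : Fin n → ℝ, ridge X Ω K₁ y = ridge X 1 K₂ y) ↔
      ((∃ (Γ : Matrix (Fin k) (Fin k) ℝ) (Δ : Matrix (Fin (n - k)) (Fin (n - k)) ℝ),
          Γ.PosDef ∧ Δ.PosDef ∧ Ω = X * Γ * Xᵀ + Z * Δ * Zᵀ) ∧
        (∀ β : Fin k → ℝ,
          ((Xᵀ * Ω⁻¹ * X + K₁)⁻¹ * (Xᵀ * Ω⁻¹ * X)).mulVec β =
            ((Xᵀ * X + K₂)⁻¹ * (Xᵀ * X)).mulVec β)) := by
  have hZX : Zᵀ * X = 0 := by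
    have := congrArg Matrix.transpose hXZ
    simpa using this
  have hΩu : IsUnit Ω.det := (Matrix.isUnit_iff_isUnit_det _).1 hΩ.isUnit
  have hA := ridge_unit X hX Ω hΩ K₁ hK₁
  have hB := ridge_unit X hX 1 Matrix.PosDef.one K₂ hK₂
  have hG := gram_unit X hX
  have hone := key_one hn X hX Z hXZ hZ
  have hl : (∀ y : Fin n → ℝ, ridge X Ω K₁ y = ridge X 1 K₂ y) ↔
      (Xᵀ * Ω⁻¹ * X + K₁)⁻¹ * (Xᵀ * Ω⁻¹) = (Xᵀ * X + K₂)⁻¹ * Xᵀ := by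
    simp only [ridge, inv_one, Matrix.mul_one]
    rw [← Matrix.mul_assoc]
    exact ⟨fun h => Matrix.ext_iff_mulVec.2 h, fun h y => by rw [h]⟩
  have hr : (∀ β : Fin k → ℝ,
          ((Xᵀ * Ω⁻¹ * X + K₁)⁻¹ * (Xᵀ * Ω⁻¹ * X)).mulVec β =
            ((Xᵀ * X + K₂)⁻¹ * (Xᵀ * X)).mulVec β) ↔
      (Xᵀ * Ω⁻¹ * X + K₁)⁻¹ * (Xᵀ * Ω⁻¹ * X) = (Xᵀ * X + K₂)⁻¹ * (Xᵀ * X) :=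
    ⟨fun h => Matrix.ext_iff_mulVec.2 h, fun h y => by rw [h]⟩
  rw [hl, hr]
  rw [inv_one, Matrix.mul_one] at hB
  generalize hAd : Xᵀ * Ω⁻¹ * X + K₁ = A at *
  generalize hBd : Xᵀ * X + K₂ = B at *
  constructor
  · intro h
    have h1 : Xᵀ * Ω⁻¹ = A * B⁻¹ * Xᵀ := by
      rw [Matrix.mul_assoc, ← h, Matrix.mul_nonsing_inv_cancel_left _ _ hA]
    have h2 : Xᵀ = A * B⁻¹ * (Xᵀ * Ω) := by
      rw [← Matrix.mul_assoc, ← h1, Matrix.nonsing_inv_mul_cancel_right _ _ hΩu]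
    have h3 : B * A⁻¹ * Xᵀ = Xᵀ * Ω := by
      conv_lhs => rw [h2]
      rw [Matrix.mul_assoc, Matrix.mul_assoc, Matrix.nonsing_inv_mul_cancel_left _ _ hA,
        Matrix.mul_nonsing_inv_cancel_left _ _ hB]
    have h4 : Xᵀ * Ω * Z = 0 := by
      rw [← h3, Matrix.mul_assoc, hXZ, Matrix.mul_zero]
    have hΩt : Ωᵀ = Ω := by
      have := hΩ.isHermitian.eq
      rwa [conjTranspose_eq_transpose_of_trivial] at this
    have h5 : Zᵀ * Ω * X = 0 := by
      have := congrArg Matrix.transpose h4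
      simpa [hΩt, Matrix.mul_assoc] using this
    refine ⟨⟨_, _, pd_comp X hX Ω hΩ, pd_comp Z hZ Ω hΩ, ?_⟩, ?_⟩
    · have e : Ω = (X * (Xᵀ * X)⁻¹ * Xᵀ + Z * (Zᵀ * Z)⁻¹ * Zᵀ) * Ω *
          (X * (Xᵀ * X)⁻¹ * Xᵀ + Z * (Zᵀ * Z)⁻¹ * Zᵀ) := by
        rw [hone, Matrix.one_mul, Matrix.mul_one]
      have e1 : X * (Xᵀ * X)⁻¹ * Xᵀ * Ω * (Z * (Zᵀ * Z)⁻¹ * Zᵀ) = 0 := by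
        calc _ = X * (Xᵀ * X)⁻¹ * (Xᵀ * Ω * Z) * ((Zᵀ * Z)⁻¹ * Zᵀ) := by
              simp only [Matrix.mul_assoc]
          _ = 0 := by simp [h4]
      have e2 : Z * (Zᵀ * Z)⁻¹ * Zᵀ * Ω * (X * (Xᵀ * X)⁻¹ * Xᵀ) = 0 := by
        calc _ = Z * (Zᵀ * Z)⁻¹ * (Zᵀ * Ω * X) * ((Xᵀ * X)⁻¹ * Xᵀ) := by
              simp only [Matrix.mul_assoc]
          _ = 0 := by simp [h5]
      rw [Matrix.add_mul, Matrix.add_mul, Matrix.mul_add, Matrix.mul_add, e1, e2,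
        add_zero, zero_add] at e
      conv_lhs => rw [e]
      simp only [Matrix.mul_assoc]
    · rw [← Matrix.mul_assoc, h, Matrix.mul_assoc]
  · rintro ⟨⟨Γ, Δ, hΓ, hΔ, hO⟩, h⟩
    have hΓu : IsUnit Γ.det := (Matrix.isUnit_iff_isUnit_det _).1 hΓ.isUnit
    have h1 : Xᵀ * Ω = (Xᵀ * X) * Γ * Xᵀ := by
      rw [hO, Matrix.mul_add, ← Matrix.mul_assoc Xᵀ (Z * Δ), ← Matrix.mul_assoc Xᵀ Z, hXZ]
      simp [Matrix.mul_assoc]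
    have hu : IsUnit (Xᵀ * X * Γ).det := by
      rw [Matrix.det_mul]; exact hG.mul hΓu
    have h2 : Xᵀ * Ω⁻¹ = (Xᵀ * X * Γ)⁻¹ * Xᵀ := by
      have : (Xᵀ * X * Γ)⁻¹ * (Xᵀ * Ω) = Xᵀ := by
        rw [h1, Matrix.nonsing_inv_mul_cancel_left _ _ hu]
      conv_lhs => rw [← this, Matrix.mul_assoc, Matrix.mul_nonsing_inv_cancel_right _ _ hΩu]
    rw [h2, Matrix.mul_assoc, ← Matrix.mul_assoc] at h
    have h3 := congrArg (· * (Xᵀ * X)⁻¹) h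
    simp only [Matrix.mul_nonsing_inv_cancel_right _ _ hG] at h3
    rw [h2, ← Matrix.mul_assoc, h3]
end

section
/- Let K be a real k×k symmetric positive definite matrix and define Γ = (XᵀX)⁻¹XᵀΩX(XᵀX)⁻¹ (which is positive definite). Then RSS(Ω,K)(y) = RSS(I_n,K)(y) for every y ∈ ℝⁿ if and only if the following two conditions both hold: (a) K(Γ − (XᵀX)⁻¹)K = XᵀX − Γ⁻¹; (b) Ω = XΓXᵀ + Z(ZᵀZ)⁻¹Zᵀ. -/
open Matrix

/-- The residual sum of squares `RSS(Φ,K)(y) = (y − Xβ̂)ᵀ Φ⁻¹ (y − Xβ̂)`. -/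
noncomputable def RSS {n k : ℕ} (X : Matrix (Fin n) (Fin k) ℝ)
    (Φ : Matrix (Fin n) (Fin n) ℝ) (K : Matrix (Fin k) (Fin k) ℝ)
    (y : Fin n → ℝ) : ℝ :=
  (y - X.mulVec (ridge X Φ K y)) ⬝ᵥ Φ⁻¹.mulVec (y - X.mulVec (ridge X Φ K y))

lemma aux_isUnit_gram {n k : ℕ} (X : Matrix (Fin n) (Fin k) ℝ) (hX : X.rank = k)
    (Φ : Matrix (Fin n) (Fin n) ℝ) (hΦ : Φ.PosDef) : (Xᵀ * Φ * X).PosDef := by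
  have hinj : Function.Injective X.mulVec := by
    rw [Matrix.mulVec_injective_iff, linearIndependent_iff_card_eq_finrank_span, Set.finrank,
      ← Matrix.rank_eq_finrank_span_cols, hX, Fintype.card_fin]
  have := hΦ.conjTranspose_mul_mul_same hinj
  rwa [conjTranspose_eq_transpose_of_trivial] at this

lemma aux_form {n : ℕ} (P Q : Matrix (Fin n) (Fin n) ℝ) (hP : Pᵀ = P) (hQ : Qᵀ = Q)
    (h : ∀ y : Fin n → ℝ, y ⬝ᵥ P *ᵥ y = y ⬝ᵥ Q *ᵥ y) : P = Q := by
  have hP' : ∀ i j, P j i = P i j := fun i j => congrFun (congrFun hP i) j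
  have hQ' : ∀ i j, Q j i = Q i j := fun i j => congrFun (congrFun hQ i) j
  have hd : ∀ i, P i i = Q i i := fun i => by
    have := h (Pi.single i 1)
    simpa using this
  ext i j
  have := h (Pi.single i 1 + Pi.single j 1)
  simp [mulVec_add, add_dotProduct, dotProduct_add] at this
  linarith [hP' i j, hQ' i j, hd i, hd j]

lemma aux_V {n k : ℕ} (X : Matrix (Fin n) (Fin k) ℝ)
    (Φ : Matrix (Fin n) (Fin n) ℝ) (hΦ : Φ.PosDef)
    (K : Matrix (Fin k) (Fin k) ℝ) (hK : K.PosDef) : (Φ + X * K⁻¹ * Xᵀ).PosDef := by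
  have := hK.inv.posSemidef.mul_mul_conjTranspose_same X
  rw [conjTranspose_eq_transpose_of_trivial] at this
  exact hΦ.add_posSemidef this

lemma aux_RSS {n k : ℕ} (X : Matrix (Fin n) (Fin k) ℝ) (hX : X.rank = k)
    (Φ : Matrix (Fin n) (Fin n) ℝ) (hΦ : Φ.PosDef)
    (K : Matrix (Fin k) (Fin k) ℝ) (hK : K.PosDef) (y : Fin n → ℝ) :
    RSS X Φ K y = y ⬝ᵥ ((Φ + X * K⁻¹ * Xᵀ)⁻¹ * Φ * (Φ + X * K⁻¹ * Xᵀ)⁻¹) *ᵥ y := by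
  have hV := aux_V X Φ hΦ K hK
  have hM := (aux_isUnit_gram X hX Φ⁻¹ hΦ.inv).add_posSemidef hK.posSemidef
  have hVs : ((Φ + X * K⁻¹ * Xᵀ)⁻¹)ᵀ = (Φ + X * K⁻¹ * Xᵀ)⁻¹ := by
    have := hV.inv.isHermitian.eq
    rwa [conjTranspose_eq_transpose_of_trivial] at this
  have hΦs : Φᵀ = Φ := by
    have := hΦ.isHermitian.eq
    rwa [conjTranspose_eq_transpose_of_trivial] at this
  have uV := (isUnit_iff_isUnit_det _).1 hV.isUnit
  have uM := (isUnit_iff_isUnit_det _).1 hM.isUnit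
  have uΦ := (isUnit_iff_isUnit_det _).1 hΦ.isUnit
  have uK := (isUnit_iff_isUnit_det _).1 hK.isUnit
  have key : (1 - X * (Xᵀ * Φ⁻¹ * X + K)⁻¹ * Xᵀ * Φ⁻¹) * (Φ + X * K⁻¹ * Xᵀ) = Φ := by
    have h1 : (Xᵀ * Φ⁻¹ * X + K)⁻¹ * (Xᵀ * Φ⁻¹ * X) * K⁻¹ + (Xᵀ * Φ⁻¹ * X + K)⁻¹ = K⁻¹ := by
      calc _ = (Xᵀ * Φ⁻¹ * X + K)⁻¹ * (Xᵀ * Φ⁻¹ * X + K) * K⁻¹ := by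
            rw [Matrix.mul_add, Matrix.add_mul, Matrix.mul_assoc _ K, Matrix.mul_nonsing_inv _ uK,
              Matrix.mul_one]
        _ = _ := by rw [Matrix.nonsing_inv_mul _ uM, Matrix.one_mul]
    have h2 : X * (Xᵀ * Φ⁻¹ * X + K)⁻¹ * Xᵀ * Φ⁻¹ * (Φ + X * K⁻¹ * Xᵀ) = X * K⁻¹ * Xᵀ := by
      calc _ = X * (Xᵀ * Φ⁻¹ * X + K)⁻¹ * Xᵀ * (Φ⁻¹ * Φ) +
            X * ((Xᵀ * Φ⁻¹ * X + K)⁻¹ * (Xᵀ * Φ⁻¹ * X) * K⁻¹) * Xᵀ := by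
              simp only [Matrix.mul_add, Matrix.mul_assoc]
        _ = X * ((Xᵀ * Φ⁻¹ * X + K)⁻¹ * (Xᵀ * Φ⁻¹ * X) * K⁻¹ + (Xᵀ * Φ⁻¹ * X + K)⁻¹) * Xᵀ := by
              rw [Matrix.nonsing_inv_mul _ uΦ, Matrix.mul_one, Matrix.mul_add, Matrix.add_mul,
                add_comm]
        _ = _ := by rw [h1]
    rw [Matrix.sub_mul, h2, Matrix.one_mul, add_sub_cancel_right]
  have key2 : 1 - X * (Xᵀ * Φ⁻¹ * X + K)⁻¹ * Xᵀ * Φ⁻¹ = Φ * (Φ + X * K⁻¹ * Xᵀ)⁻¹ := by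
    calc _ = (1 - X * (Xᵀ * Φ⁻¹ * X + K)⁻¹ * Xᵀ * Φ⁻¹) * (Φ + X * K⁻¹ * Xᵀ)
          * (Φ + X * K⁻¹ * Xᵀ)⁻¹ := by
            rw [Matrix.mul_assoc _ (Φ + X * K⁻¹ * Xᵀ), Matrix.mul_nonsing_inv _ uV, Matrix.mul_one]
      _ = _ := by rw [key]
  have h3 : y - X.mulVec (ridge X Φ K y) = (Φ * (Φ + X * K⁻¹ * Xᵀ)⁻¹) *ᵥ y := by
    rw [← key2, Matrix.sub_mulVec, Matrix.one_mulVec, ridge, Matrix.mulVec_mulVec]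
    simp only [Matrix.mul_assoc]
  unfold RSS
  rw [h3, Matrix.mulVec_mulVec, ← Matrix.mul_assoc, Matrix.nonsing_inv_mul _ uΦ, Matrix.one_mul]
  generalize (Φ + X * K⁻¹ * Xᵀ)⁻¹ = U at *
  rw [← Matrix.mulVec_mulVec y (U * Φ) U]
  conv_rhs => rw [Matrix.dotProduct_mulVec, ← Matrix.mulVec_transpose, Matrix.transpose_mul, hVs, hΦs]

lemma aux_proj {n k : ℕ} (hn : k < n)
    (X : Matrix (Fin n) (Fin k) ℝ)
    (Z : Matrix (Fin n) (Fin (n - k)) ℝ) (hXZ : Xᵀ * Z = 0)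
    (uB : IsUnit (Xᵀ * X).det) (uC : IsUnit (Zᵀ * Z).det) :
    X * (Xᵀ * X)⁻¹ * Xᵀ + Z * (Zᵀ * Z)⁻¹ * Zᵀ = 1 := by
  have hZX : Zᵀ * X = 0 := by
    have := congrArg transpose hXZ
    simpa using this
  set N := X * (Xᵀ * X)⁻¹ * Xᵀ + Z * (Zᵀ * Z)⁻¹ * Zᵀ with hN
  have hNX : N * X = X := by
    rw [hN, Matrix.add_mul, Matrix.mul_assoc _ Xᵀ, Matrix.mul_assoc _ Zᵀ, hZX,
      Matrix.mul_assoc X, Matrix.nonsing_inv_mul _ uB]; simp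
  have hNZ : N * Z = Z := by
    rw [hN, Matrix.add_mul, Matrix.mul_assoc _ Xᵀ, Matrix.mul_assoc _ Zᵀ, hXZ,
      Matrix.mul_assoc Z, Matrix.nonsing_inv_mul _ uC]; simp
  have hNN : N * N = N := by
    conv_lhs => rw [hN, ← hN]
    conv_lhs => arg 2; rw [hN]
    rw [Matrix.mul_add, ← Matrix.mul_assoc, ← Matrix.mul_assoc, hNX, ← Matrix.mul_assoc,
      ← Matrix.mul_assoc, hNZ]
  have hNt : Nᵀ = N := by
    rw [hN]; simp [Matrix.transpose_nonsing_inv, Matrix.mul_assoc]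
  have htr : N.trace = n := by
    rw [hN, Matrix.trace_add, Matrix.mul_assoc, Matrix.trace_mul_comm, Matrix.mul_assoc,
      Matrix.nonsing_inv_mul _ uB, Matrix.mul_assoc, Matrix.trace_mul_comm, Matrix.mul_assoc,
      Matrix.nonsing_inv_mul _ uC, Matrix.trace_one, Matrix.trace_one, Fintype.card_fin,
      Fintype.card_fin, Nat.cast_sub hn.le]
    ring
  have : (1 - N)ᴴ * (1 - N) = 1 - N := by
    rw [conjTranspose_eq_transpose_of_trivial, transpose_sub, hNt, transpose_one, Matrix.mul_sub,
      Matrix.sub_mul, Matrix.sub_mul, hNN]; simp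
  have h0 : 1 - N = 0 := by
    rw [← Matrix.trace_conjTranspose_mul_self_eq_zero_iff, this, Matrix.trace_sub, htr]; simp
  exact (sub_eq_zero.1 h0).symm

lemma aux_Q {n k : ℕ} (X : Matrix (Fin n) (Fin k) ℝ)
    (Φ : Matrix (Fin n) (Fin n) ℝ) (uΦ : IsUnit Φ.det) (L : Matrix (Fin k) (Fin k) ℝ) :
    (Φ + X * L * Xᵀ) * Φ⁻¹ * (Φ + X * L * Xᵀ) =
      Φ + X * L * Xᵀ + X * L * Xᵀ + X * (L * (Xᵀ * Φ⁻¹ * X) * L) * Xᵀ := by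
  rw [Matrix.add_mul, Matrix.mul_nonsing_inv _ uΦ, Matrix.add_mul, Matrix.one_mul, Matrix.mul_add,
    Matrix.mul_assoc _ Φ⁻¹ Φ, Matrix.nonsing_inv_mul _ uΦ, Matrix.mul_one]
  simp only [Matrix.mul_assoc, add_assoc]

lemma aux_main {n k : ℕ} (X : Matrix (Fin n) (Fin k) ℝ) (hX : X.rank = k)
    (Ω : Matrix (Fin n) (Fin n) ℝ) (hΩ : Ω.PosDef)
    (K : Matrix (Fin k) (Fin k) ℝ) (hK : K.PosDef) :
    (∀ y : Fin n → ℝ, RSS X Ω K y = RSS X 1 K y) ↔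
      Ω = 1 + X * (K⁻¹ * (Xᵀ * X - Xᵀ * Ω⁻¹ * X) * K⁻¹) * Xᵀ := by
  have hI : (1 : Matrix (Fin n) (Fin n) ℝ).PosDef := Matrix.PosDef.one
  have hsymm : ∀ Φ : Matrix (Fin n) (Fin n) ℝ, Φ.PosDef →
      ((Φ + X * K⁻¹ * Xᵀ)⁻¹ * Φ * (Φ + X * K⁻¹ * Xᵀ)⁻¹)ᵀ =
        (Φ + X * K⁻¹ * Xᵀ)⁻¹ * Φ * (Φ + X * K⁻¹ * Xᵀ)⁻¹ := by
    intro Φ hΦ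
    have h1 := (aux_V X Φ hΦ K hK).inv.isHermitian.eq
    have h2 := hΦ.isHermitian.eq
    rw [conjTranspose_eq_transpose_of_trivial] at h1 h2
    rw [transpose_mul, transpose_mul, h1, h2, Matrix.mul_assoc _ Φ]
  have hinv : ∀ Φ : Matrix (Fin n) (Fin n) ℝ, Φ.PosDef →
      ((Φ + X * K⁻¹ * Xᵀ)⁻¹ * Φ * (Φ + X * K⁻¹ * Xᵀ)⁻¹)⁻¹ =
        Φ + X * K⁻¹ * Xᵀ + X * K⁻¹ * Xᵀ + X * (K⁻¹ * (Xᵀ * Φ⁻¹ * X) * K⁻¹) * Xᵀ := by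
    intro Φ hΦ
    have uV := (isUnit_iff_isUnit_det _).1 (aux_V X Φ hΦ K hK).isUnit
    rw [Matrix.mul_inv_rev, Matrix.mul_inv_rev, Matrix.nonsing_inv_nonsing_inv _ uV,
      ← Matrix.mul_assoc, aux_Q X Φ ((isUnit_iff_isUnit_det _).1 hΦ.isUnit)]
  have hu : ∀ Φ : Matrix (Fin n) (Fin n) ℝ, Φ.PosDef →
      IsUnit ((Φ + X * K⁻¹ * Xᵀ)⁻¹ * Φ * (Φ + X * K⁻¹ * Xᵀ)⁻¹).det := by
    intro Φ hΦ
    have uV := (aux_V X Φ hΦ K hK).inv.isUnit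
    exact (isUnit_iff_isUnit_det _).1 ((uV.mul hΦ.isUnit).mul uV)
  have step : (∀ y : Fin n → ℝ, RSS X Ω K y = RSS X 1 K y) ↔
      ((Ω + X * K⁻¹ * Xᵀ)⁻¹ * Ω * (Ω + X * K⁻¹ * Xᵀ)⁻¹)⁻¹ =
      ((1 + X * K⁻¹ * Xᵀ)⁻¹ * 1 * (1 + X * K⁻¹ * Xᵀ)⁻¹)⁻¹ := by
    constructor
    · intro h
      congr 1
      apply aux_form _ _ (hsymm Ω hΩ) (hsymm 1 hI)
      intro y
      rw [← aux_RSS X hX Ω hΩ K hK, ← aux_RSS X hX 1 hI K hK, h]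
    · intro h y
      rw [aux_RSS X hX Ω hΩ K hK, aux_RSS X hX 1 hI K hK,
        ← Matrix.nonsing_inv_nonsing_inv _ (hu Ω hΩ), h, Matrix.nonsing_inv_nonsing_inv _ (hu 1 hI)]
  rw [step, hinv Ω hΩ, hinv 1 hI]
  simp only [inv_one, Matrix.mul_one, Matrix.mul_sub, Matrix.sub_mul]
  constructor
  · intro h
    rw [← sub_eq_zero] at h ⊢
    rw [← h]
    abel
  · intro h
    rw [← sub_eq_zero] at h ⊢
    rw [← h]
    abel

theorem stmt_14 (n k : ℕ) (hk : 0 < k) (hn : k < n)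
    (X : Matrix (Fin n) (Fin k) ℝ) (hX : X.rank = k)
    (Z : Matrix (Fin n) (Fin (n - k)) ℝ) (hXZ : Xᵀ * Z = 0) (hZ : Z.rank = n - k)
    (Ω : Matrix (Fin n) (Fin n) ℝ) (hΩ : Ω.PosDef)
    (K : Matrix (Fin k) (Fin k) ℝ) (hK : K.PosDef)
    (Γ : Matrix (Fin k) (Fin k) ℝ) (hΓ : Γ = (Xᵀ * X)⁻¹ * Xᵀ * Ω * X * (Xᵀ * X)⁻¹) :
    (∀ y : Fin n → ℝ, RSS X Ω K y = RSS X 1 K y) ↔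
      (K * (Γ - (Xᵀ * X)⁻¹) * K = Xᵀ * X - Γ⁻¹ ∧
        Ω = X * Γ * Xᵀ + Z * (Zᵀ * Z)⁻¹ * Zᵀ) := by
  have hB := aux_isUnit_gram X hX 1 Matrix.PosDef.one
  have hC := aux_isUnit_gram Z hZ 1 Matrix.PosDef.one
  have hG := aux_isUnit_gram X hX Ω hΩ
  rw [Matrix.mul_one] at hB hC
  have uB := (isUnit_iff_isUnit_det _).1 hB.isUnit
  have uC := (isUnit_iff_isUnit_det _).1 hC.isUnit
  have uK := (isUnit_iff_isUnit_det _).1 hK.isUnit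
  have uΩ := (isUnit_iff_isUnit_det _).1 hΩ.isUnit
  have hΓ' : Γ = (Xᵀ * X)⁻¹ * (Xᵀ * Ω * X) * (Xᵀ * X)⁻¹ := by
    rw [hΓ]; simp only [Matrix.mul_assoc]
  have uΓ : IsUnit Γ.det := by
    rw [← isUnit_iff_isUnit_det, hΓ']
    exact (hB.inv.isUnit.mul hG.isUnit).mul hB.inv.isUnit
  have hP := aux_proj hn X Z hXZ uB uC
  have hZX : Zᵀ * X = 0 := by
    have := congrArg transpose hXZ
    simpa using this
  rw [aux_main X hX Ω hΩ K hK]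
  -- (b) implies A = Γ⁻¹
  have hA : Ω = X * Γ * Xᵀ + Z * (Zᵀ * Z)⁻¹ * Zᵀ → Xᵀ * Ω⁻¹ * X = Γ⁻¹ := by
    intro hb
    have h1 : Ω * X = X * (Γ * (Xᵀ * X)) := by
      rw [hb, Matrix.add_mul, Matrix.mul_assoc _ Zᵀ, hZX]
      simp [Matrix.mul_assoc]
    have h2 : X = Ω⁻¹ * X * (Γ * (Xᵀ * X)) := by
      rw [Matrix.mul_assoc, ← h1, ← Matrix.mul_assoc, Matrix.nonsing_inv_mul _ uΩ, Matrix.one_mul]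
    have h3 : Xᵀ * X = Xᵀ * Ω⁻¹ * X * Γ * (Xᵀ * X) := by
      conv_lhs => arg 2; rw [h2]
      simp only [Matrix.mul_assoc]
    have h4 : Xᵀ * Ω⁻¹ * X * Γ = 1 := by
      calc _ = Xᵀ * Ω⁻¹ * X * Γ * (Xᵀ * X) * (Xᵀ * X)⁻¹ := by
            rw [Matrix.mul_assoc _ (Xᵀ * X), Matrix.mul_nonsing_inv _ uB, Matrix.mul_one]
        _ = 1 := by rw [← h3, Matrix.mul_nonsing_inv _ uB]
    exact (Matrix.inv_eq_left_inv h4).symm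
  have hcancel : ∀ D E : Matrix (Fin k) (Fin k) ℝ, K * D * K = E ↔ D = K⁻¹ * E * K⁻¹ := by
    intro D E
    constructor
    · rintro rfl
      rw [← Matrix.mul_assoc, ← Matrix.mul_assoc, Matrix.nonsing_inv_mul _ uK, Matrix.one_mul,
        Matrix.mul_assoc, Matrix.mul_nonsing_inv _ uK, Matrix.mul_one]
    · rintro rfl
      rw [← Matrix.mul_assoc, ← Matrix.mul_assoc, Matrix.mul_nonsing_inv _ uK, Matrix.one_mul,
        Matrix.mul_assoc, Matrix.nonsing_inv_mul _ uK, Matrix.mul_one]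
  rw [hcancel]
  constructor
  · intro h
    set D := K⁻¹ * (Xᵀ * X - Xᵀ * Ω⁻¹ * X) * K⁻¹ with hD
    have hΓD : Γ = (Xᵀ * X)⁻¹ + D := by
      have e : Xᵀ * Ω * X = Xᵀ * X + (Xᵀ * X) * D * (Xᵀ * X) := by
        conv_lhs => rw [h]
        simp only [Matrix.mul_add, Matrix.add_mul, Matrix.mul_one, Matrix.mul_assoc]
      rw [hΓ', e, Matrix.mul_add, Matrix.add_mul, Matrix.nonsing_inv_mul _ uB, Matrix.one_mul,
        Matrix.mul_assoc (Xᵀ * X) D, ← Matrix.mul_assoc (Xᵀ * X)⁻¹ (Xᵀ * X),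
        Matrix.nonsing_inv_mul _ uB, Matrix.one_mul, Matrix.mul_assoc D,
        Matrix.mul_nonsing_inv _ uB, Matrix.mul_one]
    have hb : Ω = X * Γ * Xᵀ + Z * (Zᵀ * Z)⁻¹ * Zᵀ := by
      rw [h, hΓD, ← hP, Matrix.mul_add, Matrix.add_mul]
      abel
    refine ⟨?_, hb⟩
    rw [← hA hb, ← hD, hΓD]
    abel
  · rintro ⟨ha, hb⟩
    rw [hA hb, ← ha]
    conv_lhs => rw [hb]
    rw [← hP, Matrix.mul_sub, Matrix.sub_mul]
    abel
end
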